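/- (Quadratic variation of bifractional Brownian motion when 2HK = 1.) Let H ∈ (0,1), K ∈ (0,1) with 2HK = 1, and let B be a centered Gaussian process with covariance R as below. For t > 0 and n ≥ 1 set t_j = jt/n and V_t^n = Σ_{j=1}^{n} (B_{t_j} − B_{t_{j−1}})². Then V_t^n converges to t/2^{K−1} in L²(Ω) as n → ∞, that is, E[(V_t^n − 2^{1−K} t)²] → 0. -/

import Mathlib

open MeasureTheory ProbabilityTheory Filter

lemma aux_m24 (v : NNReal) : (∫ x, x^2 ∂(gaussianReal 0 v) = v) ∧ (∫ x, x^4 ∂(gaussianReal 0 v) = 3 * (v:ℝ)^2) := by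
  have h0 : (0:ℝ) ∈ interior (integrableExpSet id (gaussianReal 0 v)) := by simp
  have e2 := iteratedDeriv_mgf_zero h0 2
  have e4 := iteratedDeriv_mgf_zero h0 4
  have hE : ∀ t : ℝ, HasDerivAt (fun t : ℝ => Real.exp (0 * t + v * t ^ 2 / 2)) (v * t * Real.exp (0 * t + v * t ^ 2 / 2)) t := by
    intro t
    have : HasDerivAt (fun t : ℝ => 0 * t + v * t ^ 2 / 2) (v * t) t := by
      have := (((hasDerivAt_id t).const_mul 0).add ((((hasDerivAt_id t).pow 2).const_mul (v:ℝ)).div_const 2))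
      convert! this using 1
      simp; ring
    convert! this.exp using 1
    ring
  set E := (fun t : ℝ => Real.exp (0 * t + v * t ^ 2 / 2)) with hEdef
  have hid : ∀ t : ℝ, HasDerivAt (fun t : ℝ => t) 1 t := fun t => hasDerivAt_id t
  have d1 : deriv E = fun t => v * t * E t := funext fun t => (hE t).deriv
  have d2 : deriv (fun t => v * t * E t) = fun t => (v + v^2 * t^2) * E t := by
    funext t
    have := ((hid t).const_mul (v:ℝ)).mul (hE t)
    refine (HasDerivAt.congr_deriv this ?_).deriv
    simp only [hEdef]; ring
  have d3 : deriv (fun t => (v + v^2 * t^2) * E t) = fun t => (3 * v^2 * t + v^3 * t^3) * E t := by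
    funext t
    have := ((((hid t).pow 2).const_mul ((v:ℝ)^2)).const_add (v:ℝ)).mul (hE t)
    refine (HasDerivAt.congr_deriv this ?_).deriv
    simp only [hEdef]; norm_num; ring
  have d4 : deriv (fun t => (3 * v^2 * t + v^3 * t^3) * E t) = fun t => (3 * v^2 + 6 * v^3 * t^2 + v^4 * t^4) * E t := by
    funext t
    have := (((hid t).const_mul (3 * (v:ℝ)^2)).add (((hid t).pow 3).const_mul ((v:ℝ)^3))).mul (hE t)
    refine (HasDerivAt.congr_deriv this ?_).deriv
    simp only [hEdef]; norm_num; ring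
  rw [mgf_id_gaussianReal] at e2 e4
  change iteratedDeriv 2 E 0 = _ at e2
  change iteratedDeriv 4 E 0 = _ at e4
  simp only [iteratedDeriv_succ, iteratedDeriv_zero, d1, d2, d3, d4] at e2 e4
  constructor
  · simpa [hEdef] using e2.symm
  · simpa [hEdef] using e4.symm

lemma aux_law {Ω : Type*} [MeasurableSpace Ω] {P : Measure Ω} {X : Ω → ℝ} {v : ℝ} (hv : 0 ≤ v)
    (h : P.map X = gaussianReal 0 v.toNNReal) :
    MemLp X 4 P ∧ ∫ ω, X ω ^ 2 ∂P = v ∧ ∫ ω, X ω ^ 4 ∂P = 3 * v^2 := by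
  have hX : AEMeasurable X P := AEMeasurable.of_map_ne_zero (by rw [h]; exact IsProbabilityMeasure.ne_zero _)
  obtain ⟨h2, h4⟩ := aux_m24 v.toNNReal
  rw [Real.coe_toNNReal v hv] at h2 h4
  refine ⟨?_, ?_, ?_⟩
  · have := memLp_id_gaussianReal' (μ := 0) (v := v.toNNReal) 4 (by simp)
    rw [← h] at this
    exact (memLp_map_measure_iff this.1 hX).1 this
  · rw [← h2, ← h, integral_map hX (by fun_prop)]
  · rw [← h4, ← h, integral_map hX (by fun_prop)]

lemma aux_int {Ω : Type*} [MeasurableSpace Ω] {P : Measure Ω} {X Y : Ω → ℝ} (hX : MemLp X 4 P) (hY : MemLp Y 4 P) :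
    Integrable (fun ω => X ω ^ 2 * Y ω ^ 2) P := by
  have h : ∀ {Z : Ω → ℝ}, MemLp Z 4 P → MemLp (fun ω => Z ω ^ 2) 2 P := by
    intro Z hZ
    have : ENNReal.HolderTriple 4 4 2 := ⟨by
      rw [← ENNReal.toReal_eq_toReal_iff' (by simp) (by simp), ENNReal.toReal_add (by simp) (by simp)]
      simp; norm_num⟩
    have := hZ.mul hZ (r := 2)
    have e : (fun ω => Z ω ^ 2) = Z * Z := by funext ω; simp [pow_two]
    rw [e]; exact this
  exact (h hX).integrable_mul (h hY)

lemma aux_pair {Ω : Type*} [MeasurableSpace Ω] {P : Measure Ω} {X Y : Ω → ℝ} {A C D : ℝ}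
    (hA : 0 ≤ A) (hD : 0 ≤ D) (hC : |2 * C| ≤ A + D)
    (h : ∀ x y : ℝ, P.map (fun ω => x * X ω + y * Y ω) = gaussianReal 0 (x^2*A+2*x*y*C+y^2*D).toNNReal) :
    Integrable (fun ω => X ω ^ 2 * Y ω ^ 2) P ∧ ∫ ω, X ω ^ 2 * Y ω ^ 2 ∂P = A * D + 2 * C^2 := by
  obtain ⟨c1, c2⟩ := abs_le.1 hC
  have h1 := h 1 0
  have h2 := h 0 1
  have h3 := h 1 1
  have h4 := h 1 (-1)
  obtain ⟨l1, -, i1⟩ := aux_law (by nlinarith) h1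
  obtain ⟨l2, -, i2⟩ := aux_law (by nlinarith) h2
  obtain ⟨l3, -, i3⟩ := aux_law (by nlinarith) h3
  obtain ⟨l4, -, i4⟩ := aux_law (by nlinarith) h4
  simp only [one_mul, zero_mul, add_zero, zero_add] at l1 l2 l3 l4 i1 i2 i3 i4
  have I : ∀ {Z : Ω → ℝ}, MemLp Z 4 P → Integrable (fun ω => Z ω ^ 4) P := by
    intro Z hZ
    have := aux_int hZ hZ
    refine this.congr (ae_of_all _ fun ω => ?_)
    simp only; ring
  refine ⟨aux_int l1 l2, ?_⟩
  have : (fun ω => X ω ^ 2 * Y ω ^ 2) = fun ω => (((X ω + Y ω)^4 + (X ω + -1 * Y ω)^4) - (2 * X ω ^4 + 2 * Y ω ^4)) * (1/12) := by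
    funext ω; ring
  rw [this, integral_mul_const, integral_sub, integral_add, integral_add, integral_const_mul, integral_const_mul, i1, i2, i3, i4]
  · ring
  · exact (I l1).const_mul _
  · exact (I l2).const_mul _
  · exact (I l3)
  · exact (I l4)
  · exact (I l3).add (I l4)
  · exact ((I l1).const_mul _).add ((I l2).const_mul _)

lemma aux_sum {Ω : Type*} [MeasurableSpace Ω] {P : Measure Ω} [IsProbabilityMeasure P] (n : ℕ) (X : ℕ → Ω → ℝ) (C : ℕ → ℕ → ℝ) (c : ℝ)
    (h0 : ∀ i, 0 ≤ C i i) (hC : ∀ i k, |2 * C i k| ≤ C i i + C k k)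
    (h : ∀ i k, ∀ x y : ℝ, P.map (fun ω => x * X i ω + y * X k ω) = gaussianReal 0 (x^2*C i i+2*x*y*C i k+y^2*C k k).toNNReal) :
    ∫ ω, ((∑ i ∈ Finset.range n, X i ω ^ 2) - c)^2 ∂P =
      (∑ i ∈ Finset.range n, C i i - c)^2 + 2 * ∑ i ∈ Finset.range n, ∑ k ∈ Finset.range n, C i k ^ 2 := by
  have p := fun i k => aux_pair (h0 i) (h0 k) (hC i k) (h i k)
  have q : ∀ i, MemLp (X i) 4 P ∧ ∫ ω, X i ω ^ 2 ∂P = C i i := by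
    intro i
    have := aux_law (by simpa using h0 i) (h i i 1 0)
    simp only [one_mul, zero_mul, add_zero] at this
    refine ⟨this.1, by simpa using this.2.1⟩
  have q2 : ∀ i, Integrable (fun ω => X i ω ^ 2) P := by
    intro i
    have := (q i).1.mono_exponent (p := 2) (by norm_num)
    exact this.integrable_sq
  have e : (fun ω => ((∑ i ∈ Finset.range n, X i ω ^ 2) - c)^2) = fun ω =>
     ((∑ i ∈ Finset.range n, ∑ k ∈ Finset.range n, X i ω ^ 2 * X k ω ^ 2) - 2 * c * (∑ i ∈ Finset.range n, X i ω ^ 2)) + c^2 := by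
    funext ω
    rw [← Finset.sum_mul_sum]; ring
  have J1 : Integrable (fun ω => ∑ i ∈ Finset.range n, ∑ k ∈ Finset.range n, X i ω ^ 2 * X k ω ^ 2) P :=
    integrable_finsetSum _ fun i _ => integrable_finsetSum _ fun k _ => (p i k).1
  have J2 : Integrable (fun ω => 2 * c * (∑ i ∈ Finset.range n, X i ω ^ 2)) P :=
    (integrable_finsetSum _ fun i _ => q2 i).const_mul _
  rw [e, integral_add (f := fun ω => (∑ i ∈ Finset.range n, ∑ k ∈ Finset.range n, X i ω ^ 2 * X k ω ^ 2) - 2 * c * (∑ i ∈ Finset.range n, X i ω ^ 2)) (J1.sub J2) (integrable_const _), integral_sub J1 J2, integral_const_mul,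
    integral_finsetSum _ (fun i _ => integrable_finsetSum _ fun k _ => (p i k).1),
    integral_finsetSum _ (fun i _ => q2 i)]
  simp_rw [integral_finsetSum _ (fun k _ => (p _ k).1), (p _ _).2, (q _).2, Finset.sum_add_distrib, ← Finset.mul_sum]
  rw [← Finset.sum_mul]
  simp; ring

lemma aux_conc {K x a d : ℝ} (hK : K ∈ Set.Ioo (0:ℝ) 1) (hx : 0 ≤ x) (ha : 0 ≤ a) (hd : 0 ≤ d) :
    (x+a+d)^K + x^K ≤ (x+a)^K + (x+d)^K := by
  rcases eq_or_lt_of_le (add_nonneg ha hd) with h | h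
  · have : a = 0 := by linarith
    have : d = 0 := by linarith
    subst_vars; simp
  have c := Real.concaveOn_rpow hK.1.le hK.2.le
  have h1 := c.2 (Set.mem_Ici.2 hx) (Set.mem_Ici.2 (by linarith : 0 ≤ x+a+d)) (by positivity : 0 ≤ d/(a+d)) (by positivity : 0 ≤ a/(a+d)) (by field_simp; ring)
  have h2 := c.2 (Set.mem_Ici.2 hx) (Set.mem_Ici.2 (by linarith : 0 ≤ x+a+d)) (by positivity : 0 ≤ a/(a+d)) (by positivity : 0 ≤ d/(a+d)) (by field_simp)
  simp only [smul_eq_mul] at h1 h2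
  have e1 : d/(a+d)*x + a/(a+d)*(x+a+d) = x+a := by field_simp; ring
  have e2 : a/(a+d)*x + d/(a+d)*(x+a+d) = x+d := by field_simp; ring
  rw [e1] at h1
  rw [e2] at h2
  have e3 : d/(a+d) = 1 - a/(a+d) := by field_simp; ring
  rw [e3] at h1 h2
  linarith

lemma aux_sub {H K x y : ℝ} (hH : 0 < H) (hK : K ∈ Set.Ioo (0:ℝ) 1) {x' y' : ℝ} (hx : 0 ≤ x) (hy : 0 ≤ y) (hx' : x ≤ x') (hy' : y ≤ y') :
    (x'^(2*H) + y'^(2*H))^K - (x^(2*H) + y'^(2*H))^K - (x'^(2*H) + y^(2*H))^K + (x^(2*H) + y^(2*H))^K ≤ 0 := by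
  have h1 := Real.rpow_le_rpow hx hx' (by linarith : 0 ≤ 2*H)
  have h2 := Real.rpow_le_rpow hy hy' (by linarith : 0 ≤ 2*H)
  have h3 := Real.rpow_nonneg hx (2*H)
  have h4 := Real.rpow_nonneg hy (2*H)
  have := aux_conc hK (add_nonneg h3 h4) (sub_nonneg.2 h1) (sub_nonneg.2 h2)
  ring_nf at this ⊢
  linarith

noncomputable def auxF (H K x y : ℝ) : ℝ := (x^(2*H) + y^(2*H))^K
noncomputable def auxA (H K : ℝ) (i k : ℕ) : ℝ :=
  auxF H K (i+1) (k+1) - auxF H K i (k+1) - auxF H K (i+1) k + auxF H K i k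

lemma auxF_zero {H K x : ℝ} (hH : 0 < H) (hHK : 2*H*K=1) (hx : 0 ≤ x) : auxF H K x 0 = x := by
  unfold auxF
  rw [Real.zero_rpow (by linarith), add_zero, ← Real.rpow_mul hx, hHK, Real.rpow_one]

lemma auxF_comm (H K x y : ℝ) : auxF H K x y = auxF H K y x := by
  unfold auxF; rw [add_comm]

lemma auxF_hom {H K c x y : ℝ} (hHK : 2*H*K=1) (hc : 0 ≤ c) (hx : 0 ≤ x) (hy : 0 ≤ y) :
    auxF H K (c*x) (c*y) = c * auxF H K x y := by
  unfold auxF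
  rw [Real.mul_rpow hc hx, Real.mul_rpow hc hy, ← mul_add, Real.mul_rpow (by positivity) (by positivity),
    ← Real.rpow_mul hc, hHK, Real.rpow_one]

lemma auxA_le {H K : ℝ} (hH : 0 < H) (hK : K ∈ Set.Ioo (0:ℝ) 1) (i k : ℕ) : auxA H K i k ≤ 0 := by
  unfold auxA auxF
  exact aux_sub hH hK (by positivity) (by positivity) (by linarith) (by linarith)

lemma auxA_ge {H K : ℝ} (hH : 0 < H) (hK : K ∈ Set.Ioo (0:ℝ) 1) (hHK : 2*H*K=1) (i k : ℕ) : -1 ≤ auxA H K i k := by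
  have h1 := aux_sub hH hK (x := i) (x' := i+1) (y := 0) (y' := k) (by positivity) (by positivity) (by linarith) (by positivity)
  have h2 : auxF H K i (k+1) ≤ auxF H K (i+1) (k+1) := by
    unfold auxF
    have := hK.1
    gcongr
    linarith
  have a1 := auxF_zero (x := i) hH hHK (by positivity)
  have a2 := auxF_zero (x := i+1) hH hHK (by positivity)
  unfold auxF at a1 a2
  rw [a1, a2] at h1
  unfold auxA
  unfold auxF at *
  linarith

lemma auxA_sum {H K : ℝ} (hH : 0 < H) (hHK : 2*H*K=1) (n : ℕ) :
    ∑ i ∈ Finset.range n, ∑ k ∈ Finset.range n, auxA H K i k = (2^K - 2) * n := by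
  have : ∀ i k : ℕ, auxA H K i k = (fun k : ℕ => auxF H K (i+1) k - auxF H K i k) (k+1) - (fun k : ℕ => auxF H K (i+1) k - auxF H K i k) k := by
    intro i k; unfold auxA; push_cast; ring
  rw [Finset.sum_congr rfl (fun i _ => (Finset.sum_congr rfl (fun k _ => this i k)).trans
    (Finset.sum_range_sub (fun k : ℕ => auxF H K (i+1) k - auxF H K i k) n))]
  have : ∀ i : ℕ, auxF H K (i+1) n - auxF H K i n - (auxF H K (i+1) (0:ℕ) - auxF H K i (0:ℕ))
     = (fun i : ℕ => auxF H K i n - auxF H K i (0:ℕ)) (i+1) - (fun i : ℕ => auxF H K i n - auxF H K i (0:ℕ)) i := by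
    intro i; push_cast; ring
  rw [Finset.sum_congr rfl (fun i _ => this i), Finset.sum_range_sub (fun i : ℕ => auxF H K i n - auxF H K i (0:ℕ))]
  have hd : auxF H K n n = 2^K * n := by
    have := auxF_hom (H := H) (K := K) (c := n) (x := 1) (y := 1) hHK (by positivity) (by simp) (by simp)
    rw [mul_one] at this
    rw [this]; unfold auxF; norm_num; ring
  rw [auxF_comm H K (0:ℕ) n, hd]
  simp only [Nat.cast_zero]
  rw [auxF_zero hH hHK (by positivity), auxF_zero hH hHK (by positivity)]
  ring

lemma auxA_diag {H K : ℝ} (hHK : 2*H*K=1) :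
    Tendsto (fun i : ℕ => auxA H K i i) atTop (nhds 0) := by
  have hg : HasDerivAt (fun x : ℝ => auxF H K (1+x) (1-x)) 0 0 := by
    unfold auxF
    have h1 : HasDerivAt (fun x : ℝ => 1 + x) 1 0 := (hasDerivAt_id (0:ℝ)).const_add 1
    have h2 : HasDerivAt (fun x : ℝ => 1 - x) (-1) 0 := (hasDerivAt_id (0:ℝ)).const_sub 1
    have h3 := ((h1.rpow_const (p := 2*H) (by simp)).add (h2.rpow_const (p := 2*H) (by simp)))
    have h4 := h3.rpow_const (p := K) (by left; norm_num)
    refine h4.congr_deriv ?_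
    simp
  have hs := hg.tendsto_slope
  have hu : Tendsto (fun i : ℕ => 1/(2*(i:ℝ)+1)) atTop (nhdsWithin 0 {0}ᶜ) := by
    refine tendsto_nhdsWithin_iff.2 ⟨?_, Eventually.of_forall fun i => ?_⟩
    · simp only [one_div]
      refine tendsto_inv_atTop_zero.comp ?_
      exact tendsto_atTop_add_const_right _ _ (tendsto_natCast_atTop_atTop.const_mul_atTop (by norm_num))
    · simp; positivity
  have := (hs.comp hu).neg
  rw [neg_zero] at this
  refine this.congr fun i => ?_
  simp only [Function.comp, slope_def_field, sub_zero, add_zero]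
  have m0 : (0:ℝ) < 2*(i:ℝ)+1 := by positivity
  have e : auxF H K (1 + 1/(2*(i:ℝ)+1)) (1 - 1/(2*(i:ℝ)+1)) = (2/(2*i+1)) * auxF H K (i+1) i := by
    rw [← auxF_hom hHK (by positivity) (by positivity) (by positivity)]
    congr 1 <;> field_simp <;> ring
  have hd : ∀ x : ℝ, 0 ≤ x → auxF H K x x = auxF H K 1 1 * x := by
    intro x hx
    have := auxF_hom (H := H) (K := K) (c := x) (x := 1) (y := 1) hHK hx (by simp) (by simp)
    rw [mul_one] at this
    rw [this]; ring
  rw [e]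
  unfold auxA
  rw [auxF_comm H K i (i+1), hd _ (by positivity : (0:ℝ) ≤ (i:ℝ)+1), hd _ (by positivity : (0:ℝ) ≤ (i:ℝ))]
  field_simp
  ring

noncomputable def auxC (H K h : ℝ) (i k : ℕ) : ℝ :=
  h * 2^(-K) * (auxA H K i k + if i = k then 2 else 0)

lemma auxR {H K h a b : ℝ} (hHK : 2*H*K=1) (hh : 0 ≤ h) (ha : 0 ≤ a) (hb : 0 ≤ b) :
    2 ^ (-K) * (((h*a) ^ (2*H) + (h*b) ^ (2*H)) ^ K - |h*a - h*b| ^ (2*H*K)) =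
      h * 2^(-K) * (auxF H K a b - |a-b|) := by
  have := auxF_hom (H := H) (K := K) hHK hh ha hb
  unfold auxF at this ⊢
  rw [this, hHK, Real.rpow_one, ← mul_sub, abs_mul, abs_of_nonneg hh]
  ring

lemma aux_abs (i k : ℕ) : |((i:ℝ)+1)-k| + |(i:ℝ)-(k+1)| - 2 * |(i:ℝ)-k| = if i = k then 2 else 0 := by
  rcases lt_trichotomy i k with h | h | h
  · have h' : (i:ℝ) + 1 ≤ k := by exact_mod_cast h
    rw [abs_of_nonpos (by linarith), abs_of_nonpos (by linarith), abs_of_nonpos (by linarith), if_neg h.ne]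
    ring
  · subst h; simp; norm_num
  · have h' : (k:ℝ) + 1 ≤ i := by exact_mod_cast h
    rw [abs_of_nonneg (by linarith), abs_of_nonneg (by linarith), abs_of_nonneg (by linarith), if_neg h.ne']
    ring

lemma aux_var {H K h : ℝ} (hHK : 2*H*K=1) (hh : 0 ≤ h) (i k : ℕ) (x y : ℝ) (ts c : Fin 4 → ℝ)
    (hts : ts = ![h*((i:ℝ)+1), h*i, h*((k:ℝ)+1), h*k]) (hc : c = ![x,-x,y,-y]) :
    (∑ i, ∑ j, c i * c j *
          (2 ^ (-K) * (((ts i) ^ (2*H) + (ts j) ^ (2*H)) ^ K - |ts i - ts j| ^ (2*H*K)))) =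
    x^2 * auxC H K h i i + 2*x*y*auxC H K h i k + y^2 * auxC H K h k k := by
  have e : ∀ a b, 2 ^ (-K) * (((ts a) ^ (2*H) + (ts b) ^ (2*H)) ^ K - |ts a - ts b| ^ (2*H*K)) =
     h * 2^(-K) * (auxF H K (![(i:ℝ)+1, i, (k:ℝ)+1, k] a) (![(i:ℝ)+1, i, (k:ℝ)+1, k] b) -
        |![(i:ℝ)+1, i, (k:ℝ)+1, k] a - ![(i:ℝ)+1, i, (k:ℝ)+1, k] b|) := by
    intro a b
    have pos : ∀ a, 0 ≤ ![(i:ℝ)+1, i, (k:ℝ)+1, k] a := by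
      intro a; fin_cases a <;> simp <;> positivity
    have ht : ∀ a, ts a = h * ![(i:ℝ)+1, i, (k:ℝ)+1, k] a := by
      intro a; rw [hts]; fin_cases a <;> simp
    rw [ht a, ht b, auxR hHK hh (pos a) (pos b)]
  simp_rw [e, hc]
  simp only [Fin.sum_univ_four]
  simp
  unfold auxC auxA
  rw [← aux_abs i i, ← aux_abs i k, ← aux_abs k k]
  rw [auxF_comm H K k i, auxF_comm H K (k+1) i, auxF_comm H K k (i+1), auxF_comm H K (k+1) (i+1),
    auxF_comm H K i (i+1), auxF_comm H K k (k+1), abs_sub_comm (k:ℝ) i, abs_sub_comm (k:ℝ) (i+1),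
    abs_sub_comm ((k:ℝ)+1) i]
  simp
  ring

lemma auxC_bounds {H K h : ℝ} (hH : 0 < H) (hK : K ∈ Set.Ioo (0:ℝ) 1) (hHK : 2*H*K=1) (hh : 0 ≤ h) (i k : ℕ) :
    0 ≤ auxC H K h i i ∧ |2 * auxC H K h i k| ≤ auxC H K h i i + auxC H K h k k := by
  have p : 0 ≤ h * (2:ℝ)^(-K) := by positivity
  have g := auxA_ge hH hK hHK
  have l := auxA_le hH hK
  have h0 : ∀ i, 0 ≤ auxC H K h i i := by
    intro i
    unfold auxC
    refine mul_nonneg p ?_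
    have := g i i
    simp; linarith
  refine ⟨h0 i, ?_⟩
  by_cases hik : i = k
  · subst hik
    rw [abs_of_nonneg (by linarith [h0 i])]; linarith
  · unfold auxC
    simp only [hik, if_true, if_false, add_zero]
    rw [show 2 * (h * (2:ℝ)^(-K) * auxA H K i k) = (h * (2:ℝ)^(-K)) * (2 * auxA H K i k) by ring, abs_mul, abs_of_nonneg p, ← mul_add]
    refine mul_le_mul_of_nonneg_left ?_ p
    rw [abs_of_nonpos (by linarith [l i k])]
    linarith [g i k, g i i, g k k]

lemma auxC_sq {H K : ℝ} (hH : 0 < H) (hK : K ∈ Set.Ioo (0:ℝ) 1) (hHK : 2*H*K=1) (h : ℝ) (n : ℕ) :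
    ∑ i ∈ Finset.range n, ∑ k ∈ Finset.range n, auxC H K h i k ^ 2 ≤ (h * 2^(-K))^2 * (6 * n) := by
  have b : ∀ i k : ℕ, auxC H K h i k ^ 2 ≤ (h * 2^(-K))^2 * (- auxA H K i k + if i = k then 4 else 0) := by
    intro i k
    unfold auxC
    rw [mul_pow]
    refine mul_le_mul_of_nonneg_left ?_ (sq_nonneg _)
    have g := auxA_ge hH hK hHK i k
    have l := auxA_le hH hK i k
    split_ifs <;> nlinarith
  refine (Finset.sum_le_sum fun i _ => Finset.sum_le_sum fun k _ => b i k).trans ?_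
  simp_rw [← Finset.mul_sum]
  refine mul_le_mul_of_nonneg_left ?_ (sq_nonneg _)
  simp_rw [Finset.sum_add_distrib, Finset.sum_neg_distrib]
  rw [auxA_sum hH hHK]
  have : ∑ i ∈ Finset.range n, ∑ k ∈ Finset.range n, (if i = k then (4:ℝ) else 0) = 4 * n := by
    rw [Finset.sum_congr rfl (g := fun _ => (4:ℝ))]
    · simp; ring
    · intro i hi
      rw [Finset.sum_ite_eq, if_pos hi]
  rw [this]
  have : (0:ℝ) ≤ 2^K * n := by positivity
  nlinarith


/-- Let `H ∈ (0,1)`, `K ∈ (0,1)` with `2HK = 1`, and let `B` be a centered Gaussian process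
with the bifractional covariance `R(t,s) = 2^{-K}((t^{2H} + s^{2H})^K - |t-s|^{2HK})`.
With `t_j = jt/n` and `V_t^n = ∑_{j=1}^n (B_{t_j} - B_{t_{j-1}})²`, one has
`V_t^n → t/2^{K-1} = 2^{1-K} t` in `L²(Ω)`, i.e. `E[(V_t^n - 2^{1-K} t)²] → 0`, as `n → ∞`. -/
theorem bifBm_quadratic_variation_L2
    (H K : ℝ) (hH : H ∈ Set.Ioo (0:ℝ) 1) (hK : K ∈ Set.Ioo (0:ℝ) 1) (hHK : 2*H*K = 1)
    {Ω : Type*} [MeasurableSpace Ω] (P : Measure Ω) [IsProbabilityMeasure P]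
    (B : ℝ → Ω → ℝ)
    (hB : ∀ (m : ℕ) (ts : Fin m → ℝ) (c : Fin m → ℝ), (∀ i, 0 ≤ ts i) →
      P.map (fun ω => ∑ i, c i * B (ts i) ω) =
        gaussianReal 0 (Real.toNNReal (∑ i, ∑ j, c i * c j *
          (2 ^ (-K) * (((ts i) ^ (2*H) + (ts j) ^ (2*H)) ^ K - |ts i - ts j| ^ (2*H*K))))))
    (t : ℝ) (ht : 0 < t) :
    Tendsto (fun n : ℕ =>
        ∫ ω, ((∑ j ∈ Finset.Icc 1 n,
          (B ((j : ℝ) * t / n) ω - B (((j : ℝ) - 1) * t / n) ω)^2)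
            - 2 ^ ((1:ℝ) - K) * t)^2 ∂P)
      atTop (nhds 0) := by
  have hH0 := hH.1
  have key : ∀ n : ℕ, ∫ ω, ((∑ j ∈ Finset.Icc 1 n,
          (B ((j : ℝ) * t / n) ω - B (((j : ℝ) - 1) * t / n) ω)^2)
            - 2 ^ ((1:ℝ) - K) * t)^2 ∂P =
      (∑ i ∈ Finset.range n, auxC H K (t/n) i i - 2 ^ ((1:ℝ) - K) * t)^2 +
        2 * ∑ i ∈ Finset.range n, ∑ k ∈ Finset.range n, auxC H K (t/n) i k ^ 2 := by
    intro n
    have hh : 0 ≤ t / n := by positivity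
    rw [← aux_sum (P := P) n (fun i ω => B (t/n*((i:ℝ)+1)) ω - B (t/n*i) ω) (auxC H K (t/n)) (2 ^ ((1:ℝ) - K) * t)
      (fun i => (auxC_bounds hH0 hK hHK hh i i).1) (fun i k => (auxC_bounds hH0 hK hHK hh i k).2)]
    · congr 1
      funext ω
      congr 2
      rw [Finset.range_eq_Ico, ← Finset.Ico_add_one_right_eq_Icc, ← Finset.sum_Ico_add' _ 0 n 1]
      refine Finset.sum_congr rfl fun i _ => ?_
      push_cast
      rw [show ((i:ℝ)+1)*t/n = t/n*(i+1) by ring, show ((i:ℝ)+1-1)*t/n = t/n*i by ring]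
    · intro i k x y
      have := hB 4 ![t/n*((i:ℝ)+1), t/n*i, t/n*((k:ℝ)+1), t/n*k] ![x,-x,y,-y] (by
        intro a; fin_cases a <;> simp <;> positivity)
      rw [aux_var hHK hh i k x y _ _ rfl rfl] at this
      rw [← this]
      congr 1
      funext ω
      simp [Fin.sum_univ_four]
      ring
  simp_rw [key]
  have T1 : Tendsto (fun n : ℕ => ∑ i ∈ Finset.range n, auxC H K (t/n) i i - 2 ^ ((1:ℝ) - K) * t) atTop (nhds 0) := by
    have := ((auxA_diag hHK (H := H) (K := K)).cesaro).const_mul (t * 2^(-K))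
    rw [mul_zero] at this
    refine this.congr' ?_
    filter_upwards [eventually_gt_atTop 0] with n hn
    have hn' : (n:ℝ) ≠ 0 := by positivity
    unfold auxC
    simp only [if_true]
    rw [← Finset.mul_sum, Finset.sum_add_distrib, Real.rpow_sub (by norm_num), Real.rpow_neg (by norm_num)]
    simp
    field_simp
    ring
  have T2 : Tendsto (fun n : ℕ => ∑ i ∈ Finset.range n, ∑ k ∈ Finset.range n, auxC H K (t/n) i k ^ 2) atTop (nhds 0) := by
    have := (tendsto_one_div_atTop_nhds_zero_nat (𝕜 := ℝ)).const_mul (6 * (t * 2^(-K))^2)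
    rw [mul_zero] at this
    refine squeeze_zero (fun n => Finset.sum_nonneg fun i _ => Finset.sum_nonneg fun k _ => sq_nonneg _) (fun n => ?_) this
    refine (auxC_sq hH0 hK hHK _ n).trans (le_of_eq ?_)
    rcases Nat.eq_zero_or_pos n with h | h
    · subst h; simp
    · have hn' : (n:ℝ) ≠ 0 := by positivity
      field_simp
  simpa using (T1.pow 2).add (T2.const_mul 2)
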